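/- Fix a prime p and an integer n ≥ 2, and let m be an integer with 1 ≤ m ≤ p^{n−1} and p-adic valuation r = r_m. Let b and c be integers with 0 ≤ b, c ≤ p^n − 2, such that c is in layer i for some i ≤ r and b is in layer s for some s with r < s ≤ n−1. Assume m_{s−1} + b_s = p − 1 (where m_{s−1} is the (s−1)-th base-p digit of m and b_s the s-th base-p digit of b) and that p^{s−1} divides m. Then an n-tuple (k_0, …, k_{n−1}) of integers satisfies all of: (1) max{0, c_j − b_j} ≤ k_j ≤ c_j for every j; (2) there exists an index l with k_l < p − 1 − b_l; (3) p^n − 1 divides ⌊m⌋_s·p − m·p + Σ_{j=0}^{n−1} p^j·(b_j − c_j + 2k_j), if and only if c = b̄ (the completion of b), k_j = 0 for all j ≠ s, and k_s = p−1−b_s. In particular there is exactly one such tuple when c = b̄, and none when c ≠ b̄. -/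

import Mathlib

/-- The `i`-th base-`p` digit of `a`. -/
def digit (p a i : ℕ) : ℕ := a / p ^ i % p

/-- `a` is in layer `s` (for `0 ≤ s ≤ n-1`): `p^n - p^(s+1) ≤ a ≤ p^n - p^s - 1`. -/
def InLayer (p n a s : ℕ) : Prop :=
  s < n ∧ p ^ n - p ^ (s + 1) ≤ a ∧ a ≤ p ^ n - p ^ s - 1

/-- The floor of `m` at `s`: `⌊m⌋_s = p^s * (m / p^s)`. -/
def floorAt (p m s : ℕ) : ℕ := p ^ s * (m / p ^ s)

/-- The completion of `b` (in layer `s`): `b` with its `s`-th base-`p` digit replaced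
by `p - 1`. -/
def completionAt (p b s : ℕ) : ℕ := b + (p - 1 - digit p b s) * p ^ s

/-- Holloway's conditions on an `n`-tuple `(k_0, …, k_{n-1})`, counting the dimension of
the relevant stable homomorphism space. -/
def HolTuple (p n m s b c : ℕ) (k : ℕ → ℤ) : Prop :=
  (∀ j < n, max 0 ((digit p c j : ℤ) - (digit p b j : ℤ)) ≤ k j ∧
    k j ≤ (digit p c j : ℤ)) ∧
  (∃ l < n, k l < (p : ℤ) - 1 - (digit p b l : ℤ)) ∧
  ((p : ℤ) ^ n - 1 ∣
    (floorAt p m s : ℤ) * (p : ℤ) - (m : ℤ) * (p : ℤ) +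
      ∑ j ∈ Finset.range n,
        (p : ℤ) ^ j * ((digit p b j : ℤ) - (digit p c j : ℤ) + 2 * k j))

theorem digit_lt {p : ℕ} (hp : 0 < p) (a j : ℕ) : digit p a j < p :=
  Nat.mod_lt _ hp

theorem digit_succ (p a j : ℕ) : digit p a (j + 1) = digit p (a / p) j := by
  simp only [digit, pow_succ', Nat.div_div_eq_div_mul]

theorem sum_digit (p n a : ℕ) (ha : a < p ^ n) :
    ∑ j ∈ Finset.range n, p ^ j * digit p a j = a := by
  induction n generalizing a with
  | zero => simp at ha; simp [ha]
  | succ n ih =>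
    rw [Finset.sum_range_succ']
    have h : a / p < p ^ n := Nat.div_lt_of_lt_mul (by rwa [← pow_succ'])
    simp only [digit_succ, pow_succ', mul_assoc, ← Finset.mul_sum, ih _ h]
    simp [digit, Nat.div_add_mod]

theorem digit_sum {p : ℕ} (n : ℕ) (f : ℕ → ℕ) (hf : ∀ j < n, f j < p) (l : ℕ) (hl : l < n) :
    digit p (∑ j ∈ Finset.range n, p ^ j * f j) l = f l := by
  induction n generalizing f l with
  | zero => omega
  | succ n ih =>
    have h0 := hf 0 (by omega)
    rw [Finset.sum_range_succ']
    simp only [pow_succ', mul_assoc, ← Finset.mul_sum, pow_zero, one_mul]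
    cases l with
    | zero => simp [digit, Nat.mod_eq_of_lt h0]
    | succ l =>
      rw [digit_succ, Nat.mul_add_div (by omega), Nat.div_eq_of_lt h0, add_zero]
      exact ih (fun j => f (j + 1)) (fun j hj => hf _ (by omega)) l (by omega)

theorem InLayer.lt {p n a s : ℕ} (hp : 0 < p) (h : InLayer p n a s) : a < p ^ n := by
  have h1 : 0 < p ^ n := by positivity
  have h2 := h.2.2
  omega

theorem InLayer.digit_of_lt {p n a s j : ℕ} (hp : 0 < p) (h : InLayer p n a s)
    (hsj : s < j) (hjn : j < n) : digit p a j = p - 1 := by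
  have hlt := h.lt hp
  obtain ⟨-, h2, -⟩ := h
  have hle : p ^ (s + 1) ≤ p ^ j := Nat.pow_le_pow_right hp hsj
  obtain ⟨t, rfl⟩ : ∃ t, n = j + (t + 1) := ⟨n - j - 1, by omega⟩
  have hpos : 0 < p ^ t := by positivity
  have hq : a / p ^ j = p ^ (t + 1) - 1 := by
    apply Nat.div_eq_of_lt_le
    · rw [Nat.sub_mul, ← pow_add, add_comm (t + 1) j]; omega
    · rw [Nat.sub_add_cancel (Nat.one_le_pow _ _ hp), ← pow_add, add_comm (t + 1) j]
      exact hlt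
  obtain ⟨u, hu⟩ : ∃ u, p ^ t = u + 1 := ⟨p ^ t - 1, by omega⟩
  have hr : p ^ (t + 1) - 1 = (p - 1) + p * u := by
    rw [pow_succ', hu, mul_add]; omega
  rw [digit, hq, hr, Nat.add_mul_mod_self_left, Nat.mod_eq_of_lt (by omega)]

theorem InLayer.digit_add_one_lt {p n a s : ℕ} (hp : 1 < p) (h : InLayer p n a s) :
    digit p a s + 1 < p := by
  have hp0 : 0 < p := by omega
  obtain ⟨hs, h2, h3⟩ := h
  obtain ⟨t, rfl⟩ : ∃ t, n = s + (t + 1) := ⟨n - s - 1, by omega⟩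
  have hps : 0 < p ^ s := by positivity
  have hpt : 0 < p ^ t := by positivity
  obtain ⟨u, hu⟩ : ∃ u, p ^ t = u + 1 := ⟨p ^ t - 1, by omega⟩
  have hN : p ^ (s + (t + 1)) = p ^ s * (p * (u + 1)) := by rw [pow_add, pow_succ', hu]
  rw [hN] at h2 h3
  have hlow : p * u ≤ a / p ^ s := by
    rw [Nat.le_div_iff_mul_le hps]
    have : p ^ s * (p * (u + 1)) = p * u * p ^ s + p ^ (s + 1) := by ring
    omega
  have hup : a / p ^ s < p * (u + 1) - 1 := by
    rw [Nat.div_lt_iff_lt_mul hps, Nat.sub_mul, one_mul, mul_comm _ (p ^ s)]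
    have : p ^ s < p ^ s * (p * (u + 1)) := lt_mul_of_one_lt_right hps (by nlinarith)
    omega
  rw [mul_add] at hup
  obtain ⟨v, hv⟩ : ∃ v, a / p ^ s = v + p * u := ⟨_, (Nat.sub_add_cancel hlow).symm⟩
  rw [digit, hv, Nat.add_mul_mod_self_left, Nat.mod_eq_of_lt (by omega)]
  omega

/-- A number `p ^ n - 1` written with coefficients in `[0, 2p-2]` involves no carries. -/
theorem eq_sub_one_of_sum_eq {p : ℤ} (hp : 0 < p) (n : ℕ) (f : ℕ → ℤ)
    (hf : ∀ j < n, 0 ≤ f j ∧ f j ≤ 2 * (p - 1))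
    (hsum : ∑ j ∈ Finset.range n, p ^ j * f j = p ^ n - 1) : ∀ j < n, f j = p - 1 := by
  induction n generalizing f with
  | zero => intro j hj; omega
  | succ n ih =>
    rw [Finset.sum_range_succ'] at hsum
    simp only [pow_succ', mul_assoc, ← Finset.mul_sum, pow_zero, one_mul] at hsum
    have h0 := hf 0 (by omega)
    set S := ∑ j ∈ Finset.range n, p ^ j * f (j + 1) with hS
    have hd : f 0 - (p - 1) = p * (p ^ n - 1 - S) := by linear_combination hsum
    have hz : p ^ n - 1 - S = 0 := by
      rcases lt_trichotomy (p ^ n - 1 - S) 0 with h | h | h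
      · nlinarith
      · exact h
      · nlinarith
    have hf0 : f 0 = p - 1 := by rw [hz] at hd; linarith
    have ht := ih (fun j => f (j + 1)) (fun j hj => hf _ (by omega)) (by linarith)
    intro j hj
    cases j with
    | zero => exact hf0
    | succ j => exact ht j (by omega)

theorem sum_pow_mul_sub_one (p : ℤ) (n : ℕ) :
    ∑ j ∈ Finset.range n, p ^ j * (p - 1) = p ^ n - 1 := by
  rw [← Finset.sum_mul, geom_sum_mul]

/-- If coefficients in `[0, 2p-2]`, one of them less than `p - 1`, give a multiple of `p ^ n - 1`,
they all vanish. -/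
theorem eq_zero_of_dvd_sum {p : ℤ} (hp : 1 < p) {n : ℕ} {f : ℕ → ℤ}
    (hf : ∀ j < n, 0 ≤ f j ∧ f j ≤ 2 * (p - 1)) {l : ℕ} (hl : l < n) (hfl : f l < p - 1)
    (hdvd : p ^ n - 1 ∣ ∑ j ∈ Finset.range n, p ^ j * f j) : ∀ j < n, f j = 0 := by
  have hpow (j : ℕ) : 0 < p ^ j := by positivity
  have hnonneg : ∀ j ∈ Finset.range n, 0 ≤ p ^ j * f j := fun j hj =>
    mul_nonneg (hpow j).le (hf j (Finset.mem_range.1 hj)).1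
  have hlt : ∑ j ∈ Finset.range n, p ^ j * f j < 2 * (p ^ n - 1) := by
    rw [← sum_pow_mul_sub_one, Finset.mul_sum]
    refine Finset.sum_lt_sum (fun j hj => ?_) ⟨l, Finset.mem_range.2 hl, ?_⟩
    · nlinarith [hpow j, (hf j (Finset.mem_range.1 hj)).2]
    · nlinarith [hpow l]
  have hge := Finset.sum_nonneg hnonneg
  have hN : 0 < p ^ n - 1 := by linarith [one_lt_pow₀ hp (show n ≠ 0 by omega)]
  obtain ⟨t, ht⟩ := hdvd
  have ht2 : t < 2 := by rw [ht] at hlt; nlinarith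
  have ht0 : 0 ≤ t := by rw [ht] at hge; exact nonneg_of_mul_nonneg_right hge hN
  obtain rfl | rfl : t = 0 ∨ t = 1 := by omega
  · rw [mul_zero, Finset.sum_eq_zero_iff_of_nonneg hnonneg] at ht
    intro j hj
    exact (mul_eq_zero.1 (ht j (Finset.mem_range.2 hj))).resolve_left (hpow j).ne'
  · rw [mul_one] at ht
    exact absurd (eq_sub_one_of_sum_eq (by linarith) n f hf ht l hl) hfl.ne

theorem eq_completionAt_iff {p n b c s : ℕ} (hp : 0 < p) (hb : b < p ^ n) (hc : c < p ^ n)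
    (hs : s < n) : c = completionAt p b s ↔
      digit p c s = p - 1 ∧ ∀ j < n, j ≠ s → digit p c j = digit p b j := by
  have hsum : completionAt p b s =
      ∑ j ∈ Finset.range n, p ^ j * (if j = s then p - 1 else digit p b j) := by
    have hbs := digit_lt hp b s
    have hmem := Finset.mem_range.2 hs
    rw [completionAt]
    nth_rw 1 [← sum_digit p n b hb]
    have hrest : ∑ j ∈ (Finset.range n).erase s,
        p ^ j * (if j = s then p - 1 else digit p b j) =
        ∑ j ∈ (Finset.range n).erase s, p ^ j * digit p b j :=
      Finset.sum_congr rfl fun j hj => by rw [if_neg (Finset.ne_of_mem_erase hj)]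
    rw [← Finset.add_sum_erase _ _ hmem, ← Finset.add_sum_erase _ _ hmem, if_pos rfl, hrest]
    have : p ^ s * (p - 1) = p ^ s * digit p b s + (p - 1 - digit p b s) * p ^ s := by
      rw [mul_comm _ (p ^ s), ← mul_add]; congr 1; omega
    omega
  constructor
  · intro h
    have hd (j : ℕ) (hj : j < n) : digit p c j = if j = s then p - 1 else digit p b j := by
      rw [h, hsum]
      refine digit_sum n _ (fun j _ => ?_) j hj
      split_ifs
      · omega
      · exact digit_lt hp b j
    exact ⟨by simpa using hd s hs, fun j hj hjs => by simpa [hjs] using hd j hj⟩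
  · rintro ⟨h1, h2⟩
    rw [hsum, ← sum_digit p n c hc]
    refine Finset.sum_congr rfl fun j hj => ?_
    split_ifs with hjs
    · rw [hjs, h1]
    · rw [h2 j (Finset.mem_range.1 hj) hjs]

theorem eq_floorAt_succ_add {p m t : ℕ} (hp : 0 < p) (h : p ^ t ∣ m) :
    m = floorAt p m (t + 1) + p ^ t * digit p m t := by
  obtain ⟨q, rfl⟩ := h
  have hpt : 0 < p ^ t := by positivity
  rw [floorAt, digit, pow_succ, Nat.mul_div_mul_left _ _ hpt, Nat.mul_div_cancel_left _ hpt,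
    mul_assoc, ← mul_add, Nat.div_add_mod]

/-- Arithmetic content of Proposition 3.13(b): when `m_{s-1} + b_s = p - 1` and
`p^(s-1) ∣ m`, a tuple satisfies Holloway's conditions iff `c` is the completion of `b`,
`k_j = 0` for `j ≠ s` and `k_s = p - 1 - b_s`; in particular there is exactly one such
tuple when `c` is the completion of `b`, and none otherwise. -/
theorem holloway_tuple_iff (p n m r s i b c : ℕ) (hp : p.Prime) (hn : 2 ≤ n)
    (hm1 : 1 ≤ m) (hm2 : m ≤ p ^ (n - 1))
    (hr : p ^ r ∣ m ∧ ¬ p ^ (r + 1) ∣ m)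
    (hb : b ≤ p ^ n - 2) (hc : c ≤ p ^ n - 2)
    (hir : i ≤ r) (hci : InLayer p n c i)
    (hrs : r < s) (hsn : s ≤ n - 1) (hbs : InLayer p n b s)
    (hcond : digit p m (s - 1) + digit p b s = p - 1)
    (hdiv : p ^ (s - 1) ∣ m) :
    (∀ k : ℕ → ℤ, HolTuple p n m s b c k ↔
      (c = completionAt p b s ∧ (∀ j < n, j ≠ s → k j = 0) ∧
        k s = (p : ℤ) - 1 - (digit p b s : ℤ))) ∧
    (c = completionAt p b s →
      ∃! k : ℕ → ℤ, (∀ j, n ≤ j → k j = 0) ∧ HolTuple p n m s b c k) ∧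
    (c ≠ completionAt p b s → ¬ ∃ k : ℕ → ℤ, HolTuple p n m s b c k) := by
  have hp1 : 1 < p := hp.one_lt
  have hp0 : 0 < p := hp.pos
  have hbn := hbs.lt hp0
  have hcn := hci.lt hp0
  have hs : s < n := hbs.1
  have hcs : digit p c s = p - 1 := hci.digit_of_lt hp0 (by omega) hs
  have hci' := hci.digit_add_one_lt hp1
  have hm : (m : ℤ) * p = floorAt p m s * p + (p : ℤ) ^ s * (p - 1 - digit p b s) := by
    have hmN := eq_floorAt_succ_add hp0 hdiv
    rw [Nat.sub_add_cancel (by omega : 1 ≤ s)] at hmN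
    have hpow : (p : ℤ) ^ s = p ^ (s - 1) * p := by rw [← pow_succ, Nat.sub_add_cancel (by omega)]
    have hdig : (digit p m (s - 1) : ℤ) = p - 1 - digit p b s := by omega
    have hmZ : (m : ℤ) = floorAt p m s + (p : ℤ) ^ (s - 1) * digit p m (s - 1) := by
      exact_mod_cast hmN
    rw [hpow, ← hdig]
    linear_combination (p : ℤ) * hmZ
  have hcomp := eq_completionAt_iff hp0 hbn hcn hs
  have key (k : ℕ → ℤ) : HolTuple p n m s b c k ↔
      (c = completionAt p b s ∧ (∀ j < n, j ≠ s → k j = 0) ∧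
        k s = (p : ℤ) - 1 - (digit p b s : ℤ)) := by
    let f : ℕ → ℤ := fun j => (digit p b j : ℤ) - digit p c j + 2 * k j -
      if j = s then (p : ℤ) - 1 - digit p b s else 0
    have hsum : (floorAt p m s : ℤ) * p - m * p + ∑ j ∈ Finset.range n,
        (p : ℤ) ^ j * ((digit p b j : ℤ) - digit p c j + 2 * k j) =
        ∑ j ∈ Finset.range n, (p : ℤ) ^ j * f j := by
      simp only [f, mul_sub _ _ (ite _ _ _), Finset.sum_sub_distrib, mul_ite, mul_zero,
        Finset.sum_ite_eq', Finset.mem_range, hs, if_true]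
      linear_combination -hm
    rw [HolTuple, hsum, hcomp]
    constructor
    · rintro ⟨h1, ⟨l, hl, hkl⟩, h3⟩
      have hfb (j : ℕ) (hj : j < n) : 0 ≤ f j ∧ f j ≤ 2 * ((p : ℤ) - 1) := by
        have h := h1 j hj
        have hbj := digit_lt hp0 b j
        have hcj := digit_lt hp0 c j
        by_cases hjs : j = s
        · subst hjs; simp only [f, if_true]; omega
        · simp only [f, if_neg hjs]; omega
      have hfl : f l < (p : ℤ) - 1 := by
        have h := h1 l hl
        by_cases hls : l = s
        · subst hls; omega
        · simp only [f, if_neg hls]; omega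
      have hzero := eq_zero_of_dvd_sum (by exact_mod_cast hp1) hfb hl hfl h3
      refine ⟨⟨hcs, fun j hj hjs => ?_⟩, fun j hj hjs => ?_, ?_⟩
      · have h := h1 j hj
        have hz := hzero j hj
        simp only [f, if_neg hjs] at hz
        omega
      · have h := h1 j hj
        have hz := hzero j hj
        simp only [f, if_neg hjs] at hz
        omega
      · have hz := hzero s hs
        simp only [f, if_true] at hz
        omega
    · rintro ⟨⟨-, hd⟩, hk, hks⟩
      have hbs' := digit_lt hp0 b s
      refine ⟨fun j hj => ?_, ⟨i, hci.1, ?_⟩, ?_⟩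
      · by_cases hjs : j = s
        · subst hjs; omega
        · have := hk j hj hjs
          have := hd j hj hjs
          omega
      · have := hk i hci.1 (by omega)
        have := hd i hci.1 (by omega)
        omega
      · rw [Finset.sum_eq_zero fun j hj => ?_]
        · exact dvd_zero _
        · have hj := Finset.mem_range.1 hj
          rw [mul_eq_zero]
          right
          by_cases hjs : j = s
          · subst hjs; simp only [f, if_true]; omega
          · have := hk j hj hjs
            have := hd j hj hjs
            simp only [f, if_neg hjs]; omega
  refine ⟨key, fun h => ?_, fun h ⟨k, hk⟩ => h ((key k).1 hk).1⟩
  refine ⟨fun j => if j = s then (p : ℤ) - 1 - digit p b s else 0, ⟨fun j hj => ?_, ?_⟩, ?_⟩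
  · exact if_neg (by omega)
  · exact (key _).2 ⟨h, fun j _ hjs => if_neg hjs, if_pos rfl⟩
  · rintro k ⟨hk0, hk⟩
    obtain ⟨-, hk1, hk2⟩ := (key k).1 hk
    funext j
    by_cases hjs : j = s
    · simp [hjs, hk2]
    · by_cases hj : j < n
      · simp [hjs, hk1 j hj hjs]
      · simp [hjs, hk0 j (by omega)]
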